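/- Let I be an irreducible upper set of a finite poset P. Then χ_I is a prime element of M(P) if and only if all of the following hold: (1) I = ↑{v} for some v ∈ P; (2) every x ∈ P∖I with ↑{x} ∩ I ≠ ∅ satisfies x ≤ v; and (3) the set {x ∈ P∖I : ↑{x} ∩ I ≠ ∅} is either empty or has a maximum element. -/

import Mathlib

/-- An irreducible upper set: a nonempty upper set that is not the union of two
disjoint nonempty upper sets. -/
def IrredUpper {P : Type*} [PartialOrder P] (I : Set P) : Prop :=
  IsUpperSet I ∧ I.Nonempty ∧
    ∀ A B : Set P, IsUpperSet A → IsUpperSet B → A.Nonempty → B.Nonempty →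
      Disjoint A B → I ≠ A ∪ B

/-- `f` divides `g` in the monoid `M(P)` of monotone functions `P → ℕ`. -/
def DividesM {P : Type*} [PartialOrder P] (f g : P → ℕ) : Prop :=
  ∃ h : P → ℕ, Monotone h ∧ g = f + h

/-- `f` is a prime element of the monoid `M(P)` of monotone functions `P → ℕ`. -/
def PrimeM {P : Type*} [PartialOrder P] (f : P → ℕ) : Prop :=
  Monotone f ∧ f ≠ 0 ∧ ∀ g h : P → ℕ, Monotone g → Monotone h →
    DividesM f (g + h) → DividesM f g ∨ DividesM f h

theorem dividesM_indicator_iff {P : Type*} [PartialOrder P] {I : Set P} (hI : IsUpperSet I)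
    {g : P → ℕ} (hg : Monotone g) :
    DividesM (Set.indicator I (1 : P → ℕ)) g ↔
      (∀ y ∈ I, 1 ≤ g y) ∧ ∀ x y, x ∉ I → y ∈ I → x ≤ y → g x < g y := by
  classical
  constructor
  · rintro ⟨h, hh, rfl⟩
    refine ⟨fun y hy => ?_, fun x y hx hy hxy => ?_⟩
    · simp [hy]
    · have := hh hxy
      simp [hx, hy]
      omega
  · rintro ⟨h1, h2⟩
    refine ⟨fun x => g x - Set.indicator I (1 : P → ℕ) x, fun x y hxy => ?_, ?_⟩
    · have h3 := hg hxy
      by_cases hx : x ∈ I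
      · have hy := hI hxy hx
        simp [hx, hy]
        omega
      · by_cases hy : y ∈ I
        · have := h2 x y hx hy hxy
          simp [hx, hy]
          omega
        · simpa [hx, hy] using h3
    · funext x
      by_cases hx : x ∈ I
      · have := h1 x hx
        simp [hx]
        omega
      · simp [hx]

theorem monotone_indicator_upper {P : Type*} [PartialOrder P] {I : Set P} (hI : IsUpperSet I) :
    Monotone (Set.indicator I (1 : P → ℕ)) := by
  intro x y hxy
  by_cases hx : x ∈ I
  · simp [hx, hI hxy hx]
  · simp [hx]

theorem PrimeM.cases_upper {P : Type*} [PartialOrder P] {I A B : Set P} (hI : IsUpperSet I)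
    (hp : PrimeM (Set.indicator I (1 : P → ℕ))) (hA : IsUpperSet A) (hB : IsUpperSet B)
    (h1 : ∀ y ∈ I, y ∈ A ∨ y ∈ B)
    (h2 : ∀ x y, x ∉ I → y ∈ I → x ≤ y →
      Set.indicator A (1 : P → ℕ) x + Set.indicator B (1 : P → ℕ) x <
      Set.indicator A (1 : P → ℕ) y + Set.indicator B (1 : P → ℕ) y) :
    ((∀ y ∈ I, y ∈ A) ∧ ∀ x y, x ∉ I → y ∈ I → x ≤ y → x ∉ A) ∨
    ((∀ y ∈ I, y ∈ B) ∧ ∀ x y, x ∉ I → y ∈ I → x ≤ y → x ∉ B) := by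
  have mA := monotone_indicator_upper hA
  have mB := monotone_indicator_upper hB
  have key : ∀ C : Set P, IsUpperSet C →
      DividesM (Set.indicator I (1 : P → ℕ)) (Set.indicator C (1 : P → ℕ)) →
      ((∀ y ∈ I, y ∈ C) ∧ ∀ x y, x ∉ I → y ∈ I → x ≤ y → x ∉ C) := by
    intro C hC hd
    obtain ⟨a, b⟩ := (dividesM_indicator_iff hI (monotone_indicator_upper hC)).1 hd
    refine ⟨fun y hy => ?_, fun x y hx hy hxy hxC => ?_⟩
    · by_contra hyC
      have := a y hy
      simp [hyC] at this
    · have := b x y hx hy hxy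
      simp [hxC, hC hxy hxC] at this
  refine (hp.2.2 _ _ mA mB ?_).imp (key A hA) (key B hB)
  refine (dividesM_indicator_iff hI (mA.add mB)).2 ⟨fun y hy => ?_, h2⟩
  rcases h1 y hy with h | h <;> simp [h]

theorem stmt12 {P : Type*} [Fintype P] [PartialOrder P]
    (I : Set P) (hI : IrredUpper I) :
    PrimeM (Set.indicator I (1 : P → ℕ)) ↔
      ∃ v : P, I = Set.Ici v ∧
        (∀ x : P, x ∉ I → (∃ y ∈ I, x ≤ y) → x ≤ v) ∧
        ({x : P | x ∉ I ∧ ∃ y ∈ I, x ≤ y} = ∅ ∨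
          ∃ w ∈ {x : P | x ∉ I ∧ ∃ y ∈ I, x ≤ y},
            ∀ x ∈ {x : P | x ∉ I ∧ ∃ y ∈ I, x ≤ y}, x ≤ w) := by
  obtain ⟨hU, hne, -⟩ := hI
  constructor
  · intro hp
    obtain ⟨v, hv⟩ := (Set.toFinite I).exists_minimal hne
    have hvI : v ∈ I := hv.1
    have hUv : IsUpperSet (I \ {v}) := by
      rintro a b hab ⟨ha, hav⟩
      refine ⟨hU hab ha, ?_⟩
      rintro rfl
      exact hav (le_antisymm hab (hv.2 ha hab))
    have hIv : ∀ y ∈ I, v ≤ y := by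
      by_contra! hcon
      obtain ⟨u, hu, hvu⟩ := hcon
      have hB : IsUpperSet (I \ Set.Iic u) := by
        rintro a b hab ⟨ha, hau⟩
        exact ⟨hU hab ha, fun hb => hau (hab.trans hb)⟩
      have h1 : ∀ y ∈ I, y ∈ I \ {v} ∨ y ∈ I \ Set.Iic u := by
        intro y hy
        by_cases h : y = v
        · subst h; exact Or.inr ⟨hy, hvu⟩
        · exact Or.inl ⟨hy, h⟩
      rcases hp.cases_upper hU hUv hB h1 (by
        intro x y hx hy hxy
        rcases h1 y hy with h | h <;>
          rw [Set.indicator_of_mem h] <;> simp [hx]) with h | h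
      · exact (h.1 v hvI).2 rfl
      · exact (h.1 u hu).2 le_rfl
    have hIeq : I = Set.Ici v := Set.ext fun y => ⟨hIv y, fun h => hU h hvI⟩
    have h2 : ∀ x : P, x ∉ I → (∃ y ∈ I, x ≤ y) → x ≤ v := by
      rintro x hx ⟨y, hy, hxy⟩
      by_contra hxv
      rcases hp.cases_upper hU (hU.union (isUpperSet_Ici x)) hUv (fun y hy => Or.inl (Or.inl hy))
        (by
          intro z t hz ht hzt
          by_cases htv : t = v
          · subst htv
            have : z ∉ I ∪ Set.Ici x := by
              rintro (h | h)
              · exact hz h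
              · exact hxv (le_trans h hzt)
            rw [Set.indicator_of_notMem this]
            simp [hz, ht]
          · have h3 : t ∈ I \ {v} := ⟨ht, htv⟩
            have h4 : t ∈ I ∪ Set.Ici x := Or.inl ht
            have h5 : z ∉ I \ {v} := fun h => hz h.1
            rw [Set.indicator_of_mem h3, Set.indicator_of_mem h4, Set.indicator_of_notMem h5]
            have := Set.indicator_le_self (I ∪ Set.Ici x) (1 : P → ℕ) z
            simp only [Pi.one_apply] at this ⊢
            omega) with h | h
      · exact h.2 x y hx hy hxy (Or.inr le_rfl)
      · exact (h.1 v hvI).2 rfl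
    refine ⟨v, hIeq, h2, ?_⟩
    by_contra! hcon
    obtain ⟨hN, hmax⟩ := hcon
    obtain ⟨w, hw⟩ := (Set.toFinite {x : P | x ∉ I ∧ ∃ y ∈ I, x ≤ y}).exists_maximal hN
    obtain ⟨u, hu, huw⟩ := hmax w hw.1
    obtain ⟨hwI, y, hy, hwy⟩ := hw.1
    obtain ⟨huI, t, ht, hut⟩ := hu
    rcases hp.cases_upper hU (hU.union (isUpperSet_Ici w)) (hU.union (isUpperSet_Ici u))
      (fun y hy => Or.inl (Or.inl hy))
      (by
        intro a b ha hb hab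
        have h3 : b ∈ I ∪ Set.Ici w := Or.inl hb
        have h4 : b ∈ I ∪ Set.Ici u := Or.inl hb
        rw [Set.indicator_of_mem h3, Set.indicator_of_mem h4]
        have l1 := Set.indicator_le_self (I ∪ Set.Ici w) (1 : P → ℕ) a
        have l2 := Set.indicator_le_self (I ∪ Set.Ici u) (1 : P → ℕ) a
        simp only [Pi.one_apply] at l1 l2 ⊢
        by_cases hwa : w ≤ a
        · have haw : a ≤ w := hw.2 ⟨ha, b, hb, hab⟩ hwa
          have : a ∉ I ∪ Set.Ici u := by
            rintro (h | h)
            · exact ha h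
            · exact huw (le_trans h haw)
          rw [Set.indicator_of_notMem this]
          omega
        · have : a ∉ I ∪ Set.Ici w := by
            rintro (h | h)
            · exact ha h
            · exact hwa h
          rw [Set.indicator_of_notMem this]
          omega) with h | h
    · exact h.2 w y hwI hy hwy (Or.inr le_rfl)
    · exact h.2 u t huI ht hut (Or.inr le_rfl)
  · rintro ⟨v, hIeq, h2, h3⟩
    have hvI : v ∈ I := by rw [hIeq]; exact le_rfl
    have hIv : ∀ y ∈ I, v ≤ y := fun y hy => by rw [hIeq] at hy; exact hy
    refine ⟨monotone_indicator_upper hU, ?_, ?_⟩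
    · intro h
      have := congrFun h v
      simp [hvI] at this
    intro g h hg hh hd
    replace hd := (dividesM_indicator_iff hU (hg.add hh)).1 hd
    rw [dividesM_indicator_iff hU hg, dividesM_indicator_iff hU hh]
    obtain ⟨d1, d2⟩ := hd
    rcases h3 with h3 | ⟨w, ⟨hwI, hwy⟩, hwmax⟩
    · have hE : ∀ x y, x ∉ I → y ∈ I → ¬ x ≤ y := fun x y hx hy hxy => by
        have : x ∈ {x : P | x ∉ I ∧ ∃ y ∈ I, x ≤ y} := ⟨hx, y, hy, hxy⟩
        rw [h3] at this
        exact this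
      have key : ∀ f : P → ℕ, Monotone f → 1 ≤ f v → (∀ y ∈ I, 1 ≤ f y) ∧
          ∀ x y, x ∉ I → y ∈ I → x ≤ y → f x < f y := fun f hf h1 =>
        ⟨fun y hy => h1.trans (hf (hIv y hy)), fun x y hx hy hxy => (hE x y hx hy hxy).elim⟩
      have := d1 v hvI
      rcases (by omega : 1 ≤ g v ∨ 1 ≤ h v) with h | h
      · exact Or.inl (key _ hg h)
      · exact Or.inr (key _ hh h)
    · have key : ∀ f : P → ℕ, Monotone f → f w < f v → (∀ y ∈ I, 1 ≤ f y) ∧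
          ∀ x y, x ∉ I → y ∈ I → x ≤ y → f x < f y := fun f hf h1 =>
        ⟨fun y hy => (Nat.one_le_of_lt h1).trans (hf (hIv y hy)), fun x y hx hy hxy =>
          (hf (hwmax x ⟨hx, y, hy, hxy⟩)).trans_lt (h1.trans_le (hf (hIv y hy)))⟩
      have := d2 w v hwI hvI (h2 w hwI hwy)
      rcases (by omega : g w < g v ∨ h w < h v) with h | h
      · exact Or.inl (key _ hg h)
      · exact Or.inr (key _ hh h)
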